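/- Let A be a preorder and B a partial order. Suppose L is a monotone relation from A to B and R is a monotone relation from B to A forming an adjunction L ⊣ R, i.e.: (unit) for all a, a' ∈ A with a' ≤ a there exists b ∈ B with L b a and R a' b, and (counit) for all b, b' ∈ B, if there exists a ∈ A with R a b and L b' a, then b' ≤ b. Then there exists a unique monotone map f : A → B such that for all a ∈ A, b ∈ B: L b a ↔ b ≤ f a and R a b ↔ f a ≤ b (i.e., L = f_⋄ and R = f^⋄). -/

import Mathlib

/-- An adjunction `L ⊣ R` of monotone relations between a preorder `A` and a
poset `B` is induced by a unique monotone map `f : A → B`, i.e. `L = f_⋄` and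
`R = f^⋄`. -/
theorem left_adjoint_relations_are_maps {A B : Type*} [Preorder A] [PartialOrder B]
    (L : B → A → Prop) (R : A → B → Prop)
    (hL : ∀ b a, L b a → ∀ b' : B, b' ≤ b → ∀ a' : A, a ≤ a' → L b' a')
    (hR : ∀ a b, R a b → ∀ a' : A, a' ≤ a → ∀ b' : B, b ≤ b' → R a' b')
    (unit : ∀ a a' : A, a' ≤ a → ∃ b : B, L b a ∧ R a' b)
    (counit : ∀ b b' : B, (∃ a : A, R a b ∧ L b' a) → b' ≤ b) :
    ∃! f : A → B, Monotone f ∧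
      ∀ (a : A) (b : B), (L b a ↔ b ≤ f a) ∧ (R a b ↔ f a ≤ b) := by
  choose f hf using fun a => unit a a le_rfl
  refine ⟨f, ⟨?_, ?_⟩, ?_⟩
  · intro a a' h
    exact counit _ _ ⟨a', (hf a').2, hL _ _ (hf a).1 _ le_rfl _ h⟩
  · intro a b
    exact ⟨⟨fun h => counit _ _ ⟨a, (hf a).2, h⟩, fun h => hL _ _ (hf a).1 _ h _ le_rfl⟩,
      ⟨fun h => counit _ _ ⟨a, h, (hf a).1⟩, fun h => hR _ _ (hf a).2 _ le_rfl _ h⟩⟩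
  · rintro g ⟨_, hg⟩
    funext a
    exact le_antisymm ((hg a (f a)).2.1 (hf a).2) ((hg a (f a)).1.1 (hf a).1)
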